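/- Assume ψ₁:(0,∞)→(0,∞) has a positive continuous derivative, satisfies ψ₁(0⁺)=0, and that x ↦ ψ₁(x) and x ↦ x ψ₁′(x) are slowly varying at 0⁺, with ψ₁′(s) ∼ 1/(s ℓ(1/s)) as s → 0⁺, where ℓ is slowly varying at infinity. Then there exist a positive constant a and a complete Bernstein function ψ such that ψ ∼ a ψ₁ and ψ′ ∼ a ψ₁′ at 0⁺, ψ(1) = 1, and c(ψ,n) ≃ 1/((1+n) ℓ(1+n)). -/

import Mathlib

open MeasureTheory Filter Topology Set
open scoped Classical BigOperators

noncomputable section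

/-- Word length of `g` with respect to a set `S` of generators. -/
def wordLen {G : Type*} [Group G] (S : Set G) (g : G) : ℕ :=
  sInf {n | ∃ w : List G, (∀ x ∈ w, x ∈ S) ∧ w.length = n ∧ w.prod = g}

/-- The symmetric set associated with a generating tuple. -/
def symSet {G : Type*} [Group G] {k : ℕ} (s : Fin k → G) : Set G :=
  {x | ∃ i, x = s i ∨ x = (s i)⁻¹}

/-- Volume function: number of elements of word length at most `n`. -/
def vol {G : Type*} [Group G] (S : Set G) (n : ℕ) : ℕ :=
  Set.ncard {g : G | wordLen S g ≤ n}

/-- `S` is a finite symmetric generating set. -/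
def IsSymmGen {G : Type*} [Group G] (S : Set G) : Prop :=
  S.Finite ∧ (∀ x ∈ S, x⁻¹ ∈ S) ∧ Subgroup.closure S = ⊤

/-- Polynomial volume growth of degree `D`. -/
def PolyGrowth {G : Type*} [Group G] (S : Set G) (D : ℕ) : Prop :=
  ∃ c C : ℝ, 0 < c ∧ 0 < C ∧ ∀ n : ℕ, 1 ≤ n →
    c * (n : ℝ) ^ D ≤ (vol S n : ℝ) ∧ (vol S n : ℝ) ≤ C * (n : ℝ) ^ D

/-- A symmetric probability measure on `G`, viewed as a density. -/
def IsSymmProb {G : Type*} [Group G] (μ : G → ℝ) : Prop :=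
  (∀ g, 0 ≤ μ g) ∧ Summable μ ∧ (∑' g, μ g) = 1 ∧ (∀ g, μ g⁻¹ = μ g)

/-- Convolution of two densities on `G`. -/
def conv {G : Type*} [Group G] (μ ν : G → ℝ) : G → ℝ :=
  fun g => ∑' h, μ h * ν (h⁻¹ * g)

/-- Convolution powers `μ^{(n)}`. -/
def convPow {G : Type*} [Group G] (μ : G → ℝ) : ℕ → G → ℝ
  | 0 => fun g => if g = 1 then 1 else 0
  | n + 1 => conv μ (convPow μ n)

/-- Mass a density gives to a set. -/
def massOf {G : Type*} (μ : G → ℝ) (A : Set G) : ℝ := ∑' g : A, μ (g : G)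

/-- The weak `ρ`-moment of `μ` is bounded by `M`:
`sup_{s>0} s·μ({g : ρ(|g|) > s}) ≤ M`. -/
def WeakMomentLe {G : Type*} [Group G] (S : Set G) (ρ : ℝ → ℝ) (μ : G → ℝ) (M : ℝ) : Prop :=
  ∀ s : ℝ, 0 < s → s * massOf μ {g | ρ ((wordLen S g : ℝ)) > s} ≤ M

/-- `Φ̃_{G,ρ}(n)`: fastest decay of `φ^{(2n)}(e)` under the weak `ρ`-moment condition. -/
def PhiTilde {G : Type*} [Group G] (S : Set G) (ρ : ℝ → ℝ) (n : ℕ) : ℝ :=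
  sInf {x | ∃ μ : G → ℝ, IsSymmProb μ ∧ WeakMomentLe S ρ μ 2 ∧ x = convPow μ (2 * n) 1}

/-- Slow variation at infinity. -/
def SlowlyVarying (l : ℝ → ℝ) : Prop :=
  ∀ lam : ℝ, 0 < lam → Tendsto (fun x => l (lam * x) / l x) atTop (nhds 1)

/-- `ls` is a de Bruijn conjugate of the slowly varying function `l`. -/
def IsDeBruijnConjugate (l ls : ℝ → ℝ) : Prop :=
  SlowlyVarying ls ∧
  Tendsto (fun x => l x * ls (x * l x)) atTop (nhds 1) ∧
  Tendsto (fun x => ls x * l (x * ls x)) atTop (nhds 1)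

/-- Iterated logarithms: `log_{[0]} x = x`, `log_{[j]} x = log(1 + log_{[j-1]} x)`. -/
def logIter : ℕ → ℝ → ℝ
  | 0, x => x
  | n + 1, x => Real.log (1 + logIter n x)

/-- Base 2 iterated logarithms: `log_{2,1}(s) = log₂(1+s)`, `log_{2,j} = log_{2,1} ∘ log_{2,j-1}`. -/
def log2Iter : ℕ → ℝ → ℝ
  | 0, x => x
  | n + 1, x => Real.logb 2 (1 + log2Iter n x)

/-- `θ(s) = 1/∫_0^{1/s} dt/(t ℓ(1/t))`. -/
def thetaOf (l : ℝ → ℝ) (s : ℝ) : ℝ :=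
  1 / ∫ t in Set.Ioc (0:ℝ) (1/s), 1 / (t * l (1/t))

/-- Dirichlet form `E_μ(f,f) = (1/2) Σ_{x,y} |f(xy)-f(x)|² μ(y)`. -/
def dirichlet {G : Type*} [Group G] (μ : G → ℝ) (f : G → ℝ) : ℝ :=
  (1/2) * ∑' p : G × G, |f (p.1 * p.2) - f p.1| ^ 2 * μ p.2

/-- `f ∈ ℓ²(G)` (counting measure). -/
def MemL2 {G : Type*} (f : G → ℝ) : Prop := Summable (fun x => (f x) ^ 2)

/-- Bernstein representation `ψ(s) = a + bs + ∫ (1-e^{-st}) dν(t)`,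
with `ν` supported in `(0,∞)` and `∫ t/(1+t) dν < ∞`. -/
def IsBernsteinRep (ψ : ℝ → ℝ) (a b : ℝ) (ν : Measure ℝ) : Prop :=
  0 ≤ a ∧ 0 ≤ b ∧ ν (Set.Iic 0) = 0 ∧
  Integrable (fun t => t / (1 + t)) ν ∧
  ∀ s : ℝ, 0 < s → ψ s = a + b * s + ∫ t, (1 - Real.exp (-(s * t))) ∂ν

/-- Bernstein function (via the classical representation). -/
def IsBernstein (ψ : ℝ → ℝ) : Prop := ∃ a b ν, IsBernsteinRep ψ a b ν

/-- Complete Bernstein function: `ψ(s) = s² ∫_0^∞ e^{-ts} g(t) dt` with `g` Bernstein. -/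
def IsCompleteBernstein (ψ : ℝ → ℝ) : Prop :=
  ∃ g : ℝ → ℝ, IsBernstein g ∧
    ∀ s : ℝ, 0 < s → ψ s = s ^ 2 * ∫ t in Set.Ioi (0:ℝ), Real.exp (-(t * s)) * g t

/-- Subordination coefficients `c(ψ,n)` computed from representation data `(b,ν)`:
`c(ψ,1) = b + ∫ t e^{-t} dν`, `c(ψ,n) = (1/n!) ∫ tⁿ e^{-t} dν` for `n > 1`. -/
def cPsi (b : ℝ) (ν : Measure ℝ) (n : ℕ) : ℝ :=
  if n = 0 then 0
  else (if n = 1 then b else 0) + (1 / (n.factorial : ℝ)) * ∫ t, t ^ n * Real.exp (-t) ∂ν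

/-- Subordinated measure `Σ_{n} c(n) φ^{(n)}`. -/
def subord {G : Type*} [Group G] (φ : G → ℝ) (c : ℕ → ℝ) : G → ℝ :=
  fun x => ∑' n : ℕ, c n * convPow φ n x

/-- Tail `H_φ(r) = Σ_{|n|>r} φ(n)` of a measure on `ℤ`. -/
def Hphi (φ : ℤ → ℝ) (r : ℝ) : ℝ := ∑' n : ℤ, if r < (|n| : ℝ) then φ n else 0

/-- Truncated second moment `G_φ(r) = Σ_{|n|≤r} n² φ(n)`. -/
def Gphi (φ : ℤ → ℝ) (r : ℝ) : ℝ := ∑' n : ℤ, if (|n| : ℝ) ≤ r then (n : ℝ) ^ 2 * φ n else 0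

/-- `E_{s,φ}(f,f) = (1/2) Σ_{x∈G} Σ_{n∈ℤ} |f(xsⁿ)-f(x)|² φ(n)`. -/
def EsPhi {G : Type*} [Group G] (s : G) (φ : ℤ → ℝ) (f : G → ℝ) : ℝ :=
  (1/2) * ∑' p : G × ℤ, |f (p.1 * s ^ p.2) - f p.1| ^ 2 * φ p.2

/-- Symmetric probability measure on `ℤ`. -/
def IsSymmProbZ (φ : ℤ → ℝ) : Prop :=
  (∀ n, 0 ≤ φ n) ∧ Summable φ ∧ (∑' n, φ n) = 1 ∧ (∀ n, φ (-n) = φ n)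

/-- Measure supported on powers of generators:
`μ(g) = k⁻¹ Σ_i Σ_{n∈ℤ} w(n) 1_{s_iⁿ}(g)`. -/
def genMeasure {G : Type*} [Group G] {k : ℕ} (s : Fin k → G) (w : ℤ → ℝ) : G → ℝ :=
  fun g => (k : ℝ)⁻¹ * ∑ i : Fin k, ∑' n : ℤ, if g = s i ^ n then w n else 0

/-- Coefficients in `1-(1-x)^α = Σ_{n≥1} c_α(n) xⁿ`. -/
def cAlpha (a : ℝ) (n : ℕ) : ℝ :=
  if n = 0 then 0
  else (-1) ^ (n + 1) * (∏ j ∈ Finset.range n, (a - j)) / (n.factorial : ℝ)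

lemma potter_add (h : ℝ → ℝ) (hc : Continuous h)
    (hs : ∀ y, Tendsto (fun x => h (x + y) - h x) atTop (𝓝 0)) :
    ∃ K, ∀ x, 0 ≤ x → ∀ y, 0 ≤ y → |h (x + y) - h x| ≤ y / 2 + K := by
  obtain ⟨n, hn⟩ : ∃ n : ℕ, (interior {y : ℝ | ∀ x : ℝ, (n : ℝ) ≤ x → |h (x + y) - h x| ≤ 1}).Nonempty := by
    apply nonempty_interior_of_iUnion_of_closed
    · intro n
      simp only [ofPred_forall]
      refine isClosed_iInter fun x => isClosed_iInter fun _ => ?_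
      exact isClosed_le (by fun_prop) continuous_const
    · ext y
      simp only [mem_iUnion, mem_ofPred_eq, mem_univ, iff_true]
      have := (hs y).abs
      simp only [abs_zero] at this
      obtain ⟨X, hX⟩ := eventually_atTop.1 (this.eventually (eventually_le_nhds (show (0:ℝ) < 1 by norm_num)))
      obtain ⟨n, hn⟩ := exists_nat_ge X
      exact ⟨n, fun x hx => hX x (hn.trans hx)⟩
  obtain ⟨c, hcm⟩ := hn
  obtain ⟨d, hd, hball⟩ := Metric.isOpen_iff.1 isOpen_interior c hcm
  have hA : ∀ y, |y - c| < d → ∀ x : ℝ, (n : ℝ) ≤ x → |h (x + y) - h x| ≤ 1 := by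
    intro y hy
    exact interior_subset (hball (by rwa [Metric.mem_ball, Real.dist_eq]))
  have hB : ∀ x, (n : ℝ) + c ≤ x → ∀ y, 0 ≤ y → y ≤ d / 2 → |h (x + y) - h x| ≤ 2 := by
    intro x hx y hy hyd
    have h1 := hA (c + y) (by rw [add_sub_cancel_left, abs_of_nonneg hy]; linarith) (x - c) (by linarith)
    have h2 := hA c (by simpa using hd) (x - c) (by linarith)
    rw [show x - c + (c + y) = x + y by ring] at h1
    rw [show x - c + c = x by ring] at h2
    rw [abs_le] at *
    constructor <;> linarith [h1.1, h1.2, h2.1, h2.2]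
  have hC : ∀ k : ℕ, ∀ x, (n : ℝ) + c ≤ x → ∀ y, 0 ≤ y → y ≤ k * (d / 2) → |h (x + y) - h x| ≤ 2 * k := by
    intro k
    induction k with
    | zero =>
      intro x hx y hy hy2
      have : y = 0 := by push_cast at hy2; linarith
      simp [this]
    | succ k ih =>
      intro x hx y hy hy2
      push_cast at *
      by_cases hyd : y ≤ d / 2
      · have := hB x hx y hy hyd
        have : (0:ℝ) ≤ k := by positivity
        linarith
      · have h1 := hB x hx (d/2) (by linarith) le_rfl
        have h2 := ih (x + d/2) (by linarith) (y - d/2) (by linarith) (by linarith)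
        rw [show x + d/2 + (y - d/2) = x + y by ring] at h2
        rw [abs_le] at *
        constructor <;> linarith [h1.1, h1.2, h2.1, h2.2]
  obtain ⟨k, hk⟩ := exists_nat_ge (1 / (d / 2))
  have hk' : 1 ≤ k * (d / 2) := by rwa [div_le_iff₀ (by positivity)] at hk
  have h1 := (hs 1).abs
  simp only [abs_zero] at h1
  obtain ⟨X0, hX0⟩ := eventually_atTop.1 (h1.eventually (eventually_le_nhds (show (0:ℝ) < 1/2 by norm_num)))
  set X := max (max X0 (n + c)) 0 with hXdef
  have hXa : X0 ≤ X := (le_max_left _ _).trans (le_max_left _ _)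
  have hXb : n + c ≤ X := (le_max_right _ _).trans (le_max_left _ _)
  have hXc : 0 ≤ X := le_max_right _ _
  have hD : ∀ m : ℕ, ∀ x : ℝ, X ≤ x → ∀ y : ℝ, 0 ≤ y → y ≤ (m : ℝ) → |h (x + y) - h x| ≤ y / 2 + 2 * k := by
    intro m
    induction m with
    | zero =>
      intro x hx y hy hy2
      have : y = 0 := by push_cast at hy2; linarith
      simp [this]
    | succ m ih =>
      intro x hx y hy hy2
      push_cast at *
      by_cases hyd : y ≤ 1
      · have := hC k x (by linarith) y hy (by linarith)
        linarith
      · have h1 := hX0 x (by linarith)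
        have h2 := ih (x + 1) (by linarith) (y - 1) (by linarith) (by linarith)
        rw [show x + 1 + (y - 1) = x + y by ring] at h2
        rw [abs_le] at *
        constructor <;> linarith [h1.1, h1.2, h2.1, h2.2]
  obtain ⟨B, hB'⟩ := (isCompact_Icc (a := (0:ℝ)) (b := X)).exists_bound_of_continuousOn hc.continuousOn
  simp only [Real.norm_eq_abs] at hB'
  have hB0 : 0 ≤ B := (abs_nonneg _).trans (hB' 0 ⟨le_rfl, hXc⟩)
  have hk0 : (0:ℝ) ≤ k := by positivity
  refine ⟨2 * k + 2 * B, fun x hx y hy => ?_⟩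
  obtain ⟨m, hm⟩ := exists_nat_ge y
  by_cases hxX : X ≤ x
  · have := hD m x hxX y hy hm
    linarith
  · have h3 := hB' x ⟨hx, by linarith⟩
    by_cases hxy : x + y ≤ X
    · have h4 := hB' (x + y) ⟨by linarith, hxy⟩
      rw [abs_le] at *
      constructor <;> linarith [h3.1, h3.2, h4.1, h4.2]
    · have h4 := hB' X ⟨hXc, le_rfl⟩
      have h5 := hD m X le_rfl (x + y - X) (by linarith) (by linarith)
      rw [show X + (x + y - X) = x + y by ring] at h5
      rw [abs_le] at *
      constructor <;> linarith [h3.1, h3.2, h4.1, h4.2, h5.1, h5.2]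

lemma potter_mul (M : ℝ → ℝ) (hc : ContinuousOn M (Ioi 0)) (hp : ∀ u, 0 < u → 0 < M u)
    (hs : ∀ v, 0 < v → Tendsto (fun s => M (s * v) / M s) (𝓝[>] 0) (𝓝 1)) :
    ∃ C, 0 < C ∧ ∀ s, 0 < s → s ≤ 1 → ∀ v, 0 < v → s * v ≤ 1 →
      M (s * v) ≤ C * (v ^ (1/2:ℝ) + v ^ (-(1/2):ℝ)) * M s := by
  have hh : Continuous (fun x => Real.log (M (Real.exp (-x)))) := by
    have h1 : Continuous (fun x => M (Real.exp (-x))) :=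
      hc.comp_continuous (by fun_prop) (fun x => Real.exp_pos _)
    exact h1.log (fun x => (hp _ (Real.exp_pos _)).ne')
  obtain ⟨K, hK⟩ := potter_add _ hh (by
    intro y
    have h1 : Tendsto (fun x : ℝ => Real.exp (-x)) atTop (𝓝[>] 0) := by
      refine tendsto_nhdsWithin_iff.2 ⟨Real.tendsto_exp_neg_atTop_nhds_zero, ?_⟩
      exact Eventually.of_forall fun x => Real.exp_pos _
    have h2 := ((hs (Real.exp (-y)) (Real.exp_pos _)).comp h1).log one_ne_zero
    rw [Real.log_one] at h2
    refine h2.congr fun x => ?_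
    simp only [Function.comp]
    rw [Real.log_div (hp _ (by positivity)).ne' (hp _ (by positivity)).ne', ← Real.exp_add]
    congr 4
    ring)
  refine ⟨Real.exp K, Real.exp_pos _, fun s hs0 hs1 v hv hsv => ?_⟩
  have key : ∀ a b, 0 < a → a ≤ b → b ≤ 1 → |Real.log (M a) - Real.log (M b)| ≤ (Real.log b - Real.log a) / 2 + K := by
    intro a b ha hab hb
    have hb0 := ha.trans_le hab
    have := hK (-Real.log b) (by linarith [Real.log_nonpos hb0.le hb]) (Real.log b - Real.log a)
      (by linarith [Real.log_le_log ha hab])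
    simp only [neg_add_rev, neg_neg, neg_sub, Real.exp_log hb0] at this
    rwa [show Real.log a - Real.log b + Real.log b = Real.log a by ring, Real.exp_log ha] at this
  have hsv0 : 0 < s * v := by positivity
  have hlog : Real.log (s * v) = Real.log s + Real.log v := Real.log_mul hs0.ne' hv.ne'
  have e1 : v ^ (1/2:ℝ) = Real.exp (Real.log v / 2) := by
    rw [Real.rpow_def_of_pos hv]; ring_nf
  have e2 : v ^ (-(1/2):ℝ) = Real.exp (-(Real.log v / 2)) := by
    rw [Real.rpow_def_of_pos hv]; ring_nf
  have fin : ∀ z, Real.log (M (s * v)) - Real.log (M s) ≤ z + K → 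
      M (s * v) ≤ Real.exp K * Real.exp z * M s := by
    intro z hz
    have h1 : M (s * v) = Real.exp (Real.log (M (s * v))) := (Real.exp_log (hp _ hsv0)).symm
    have h2 : M s = Real.exp (Real.log (M s)) := (Real.exp_log (hp _ hs0)).symm
    rw [h1, h2, ← Real.exp_add, ← Real.exp_add]
    exact Real.exp_le_exp.2 (by linarith)
  have hMs := hp s hs0
  rcases le_total v 1 with h | h
  · have h1 := key (s * v) s hsv0 (by nlinarith) hs1
    rw [hlog] at h1
    refine (fin (-(Real.log v / 2)) (by linarith [(abs_le.1 h1).2])).trans ?_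
    rw [e1, e2]
    gcongr
    linarith [Real.exp_pos (Real.log v / 2)]
  · have h1 := key s (s * v) hs0 (by nlinarith) hsv
    rw [hlog] at h1
    refine (fin ((Real.log v / 2)) (by linarith [(abs_le.1 h1).1])).trans ?_
    rw [e1, e2]
    gcongr
    linarith [Real.exp_pos (-(Real.log v / 2))]

/-- dominating function -/
def domF (v : ℝ) : ℝ := (v ^ (1/2:ℝ) + v ^ (-(1/2):ℝ)) / (1 + v) ^ 2

lemma domF_integrable : IntegrableOn domF (Ioi 0) := by
  have hm : Measurable domF := by unfold domF; fun_prop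
  rw [← Ioc_union_Ioi_eq_Ioi (zero_le_one (α := ℝ)), integrableOn_union]
  constructor
  · have h1 : IntegrableOn (fun v : ℝ => 1 + v ^ (-(1/2):ℝ)) (Ioc 0 1) := by
      refine Integrable.add (integrable_const _) ?_
      have := intervalIntegral.intervalIntegrable_rpow' (a := 0) (b := 1) (r := -(1/2)) (by norm_num)
      exact (intervalIntegrable_iff_integrableOn_Ioc_of_le zero_le_one).1 this
    refine h1.mono' hm.aestronglyMeasurable ?_
    filter_upwards [ae_restrict_mem measurableSet_Ioc] with v hv
    have hv0 := hv.1
    have : 0 ≤ domF v := by unfold domF; positivity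
    rw [Real.norm_of_nonneg this]
    unfold domF
    have ha : v ^ (1/2:ℝ) ≤ 1 := Real.rpow_le_one hv0.le hv.2 (by norm_num)
    refine (div_le_self (by positivity) (by nlinarith)).trans (by linarith)
  · have h1 : IntegrableOn (fun v : ℝ => 2 * v ^ (-(3/2):ℝ)) (Ioi 1) :=
      (integrableOn_Ioi_rpow_of_lt (by norm_num) one_pos).const_mul _
    refine h1.mono' hm.aestronglyMeasurable ?_
    filter_upwards [ae_restrict_mem measurableSet_Ioi] with v hv
    have hv1 : 1 < v := hv
    have hv0 : 0 < v := by linarith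
    have : 0 ≤ domF v := by unfold domF; positivity
    rw [Real.norm_of_nonneg this]
    unfold domF
    have ha : v ^ (-(1/2):ℝ) ≤ v ^ (1/2:ℝ) := Real.rpow_le_rpow_of_exponent_le hv1.le (by norm_num)
    rw [div_le_iff₀ (by positivity)]
    have e : v ^ (1/2:ℝ) = v ^ (-(3/2):ℝ) * v ^ 2 := by
      rw [← Real.rpow_natCast, ← Real.rpow_add hv0]; norm_num
    have hz : 0 < v ^ (-(3/2):ℝ) := by positivity
    nlinarith

lemma int_inv_sq : ∫ v in Ioi (0:ℝ), 1 / (1 + v) ^ 2 = 1 := by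
  have h := integral_Ioi_of_hasDerivAt_of_nonneg (g := fun v : ℝ => -(1 + v)⁻¹)
    (g' := fun v => 1 / (1 + v) ^ 2) (a := 0) (l := 0) ?_ ?_ ?_ ?_
  · rw [h]; norm_num
  · refine ContinuousAt.continuousWithinAt ?_
    have h0 : (1:ℝ) + 0 ≠ 0 := by norm_num
    exact ((continuousAt_const.add continuousAt_id).inv₀ h0).neg
  · intro x hx
    have hx : 0 < x := hx
    have h1 := (((hasDerivAt_id x).const_add 1).inv (by simp; positivity)).neg
    refine HasDerivAt.congr_deriv (f := fun v : ℝ => -(1 + v)⁻¹) h1 ?_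
    simp only [id_eq, neg_div, neg_neg]
  · intro x hx
    have hx : 0 < x := hx
    positivity
  · have : Tendsto (fun v : ℝ => 1 + v) atTop atTop := tendsto_atTop_add_const_left _ _ tendsto_id
    simpa using this.inv_tendsto_atTop.neg

lemma abel_lim (M : ℝ → ℝ) (hc : ContinuousOn M (Ioi 0)) (hp : ∀ u, 0 < u → 0 < M u)
    (hs : ∀ v, 0 < v → Tendsto (fun s => M (s * v) / M s) (𝓝[>] 0) (𝓝 1)) :
    Tendsto (fun s => (∫ u in Ioc 0 1, M u / (s + u) ^ 2) * (s / M s)) (𝓝[>] 0) (𝓝 1) := by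
  obtain ⟨C, hC, hpot⟩ := potter_mul M hc hp hs
  set Mi : ℝ → ℝ := (Ioc 0 1).indicator M with hMi
  have hMim : Measurable Mi := by
    rw [hMi, ← piecewise_eq_indicator]
    exact ContinuousOn.measurable_piecewise (hc.mono (fun x hx => hx.1)) continuousOn_const
      measurableSet_Ioc
  have hlim : Tendsto (fun s => ∫ v in Ioi 0, Mi (s * v) / M s / (1 + v) ^ 2) (𝓝[>] 0)
      (𝓝 (∫ v in Ioi (0:ℝ), 1 / (1 + v) ^ 2)) := by
    apply tendsto_integral_filter_of_dominated_convergence (fun v => C * domF v)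
    · refine Eventually.of_forall fun s => Measurable.aestronglyMeasurable ?_
      exact ((hMim.comp (measurable_const_mul s)).div_const _).div (by fun_prop)
    · filter_upwards [Ioc_mem_nhdsGT (zero_lt_one (α := ℝ))] with s hs
      filter_upwards [ae_restrict_mem measurableSet_Ioi] with v hv
      have hv : 0 < v := hv
      have hMs := hp s hs.1
      unfold domF
      by_cases h : s * v ≤ 1
      · have hm : s * v ∈ Ioc 0 1 := ⟨mul_pos hs.1 hv, h⟩
        rw [hMi, indicator_of_mem hm]
        have h1 := hpot s hs.1 hs.2 v hv h
        have h2 := hp _ hm.1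
        rw [Real.norm_of_nonneg (by positivity), ← mul_div_assoc]
        gcongr
        rwa [div_le_iff₀ hMs]
      · rw [hMi, indicator_of_notMem (by simp only [mem_Ioc]; tauto)]
        simp only [zero_div, norm_zero]
        positivity
    · exact domF_integrable.const_mul _
    · filter_upwards [ae_restrict_mem measurableSet_Ioi] with v hv
      have hv : 0 < v := hv
      refine Tendsto.div_const ((hs v hv).congr' ?_) _
      filter_upwards [Ioc_mem_nhdsGT (show 0 < 1 / v by positivity)] with s hs
      have : s * v ≤ 1 := by have := hs.2; rwa [le_div_iff₀ hv] at this
      rw [hMi, indicator_of_mem (show s * v ∈ Ioc (0:ℝ) 1 from ⟨mul_pos hs.1 hv, this⟩)]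
  rw [int_inv_sq] at hlim
  refine hlim.congr' ?_
  filter_upwards [self_mem_nhdsWithin] with s hs
  have hs : 0 < s := hs
  have e1 : ∫ u in Ioc 0 1, M u / (s + u) ^ 2 = ∫ u in Ioi 0, Mi u / (s + u) ^ 2 := by
    have : (fun u => Mi u / (s + u)^2) = (Ioc 0 1).indicator (fun u => M u / (s + u)^2) := by
      ext u; by_cases h : u ∈ Ioc (0:ℝ) 1 <;> simp [hMi, h, -mem_Ioc]
    rw [this, setIntegral_indicator measurableSet_Ioc]
    congr 2
    ext u; simp
  have e2 := integral_comp_mul_left_Ioi (fun u => Mi u / (s + u) ^ 2) 0 hs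
  rw [mul_zero, smul_eq_mul] at e2
  rw [e1]
  have e3 : ∫ u in Ioi 0, Mi u / (s + u) ^ 2 = s * ∫ x in Ioi 0, Mi (s * x) / (s + s * x) ^ 2 := by
    rw [e2]; field_simp
  rw [e3, ← integral_const_mul, ← integral_mul_const]
  refine setIntegral_congr_fun measurableSet_Ioi fun v hv => ?_
  have hv : 0 < v := hv
  have := (hp s hs).ne'
  rw [show s + s * v = s * (1 + v) by ring]
  field_simp

lemma coef_bounds (M : ℝ → ℝ) (hc : ContinuousOn M (Ioi 0)) (hp : ∀ u, 0 < u → 0 < M u)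
    (hs : ∀ v, 0 < v → Tendsto (fun s => M (s * v) / M s) (𝓝[>] 0) (𝓝 1)) :
    ∃ c C : ℝ, 0 < c ∧ 0 < C ∧ ∀ N : ℕ, 2 ≤ N →
      c * (M (1 / N) / N) ≤ ∫ u in Ioc 0 1, M u / (1 + u) ^ N ∧ 
      ∫ u in Ioc 0 1, M u / (1 + u) ^ N ≤ C * (M (1 / N) / N) := by
  obtain ⟨C, hC, hpot⟩ := potter_mul M hc hp hs
  set Mi : ℝ → ℝ := (Ioc 0 1).indicator M with hMi
  have hMim : Measurable Mi := by
    rw [hMi, ← piecewise_eq_indicator]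
    exact ContinuousOn.measurable_piecewise (hc.mono (fun x hx => hx.1)) continuousOn_const
      measurableSet_Ioc
  have hMi0 : ∀ u, 0 ≤ Mi u := fun u => indicator_nonneg (fun x hx => (hp x hx.1).le) u
  set I := ∫ v in Ioi 0, domF v
  have hI : 0 ≤ I := setIntegral_nonneg measurableSet_Ioi fun v hv => by
    have hv : 0 < v := hv
    unfold domF; positivity
  refine ⟨1 / (3 * C * Real.exp 1) * (1 / 2), 4 * C * I + 1, by positivity, by positivity, fun N hN => ?_⟩
  have hN2 : (2:ℝ) ≤ N := by exact_mod_cast hN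
  have hN0 : (0:ℝ) < N := by linarith
  set s : ℝ := 1 / N with hsdef
  have hs0 : 0 < s := by positivity
  have hs1 : s ≤ 1 := by rw [hsdef, div_le_one hN0]; linarith
  have hMs := hp s hs0
  have e1 : ∫ u in Ioc 0 1, M u / (1 + u) ^ N = ∫ u in Ioi 0, Mi u / (1 + u) ^ N := by
    have : (fun u => Mi u / (1 + u)^N) = (Ioc 0 1).indicator (fun u => M u / (1 + u)^N) := by
      ext u; by_cases h : u ∈ Ioc (0:ℝ) 1 <;> simp [hMi, h, -mem_Ioc]
    rw [this, setIntegral_indicator measurableSet_Ioc]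
    congr 2
    ext u; simp
  have e2 := integral_comp_mul_left_Ioi (fun u => Mi u / (1 + u) ^ N) 0 hs0
  rw [mul_zero, smul_eq_mul] at e2
  have e3 : ∫ u in Ioi 0, Mi u / (1 + u) ^ N = s * ∫ x in Ioi 0, Mi (s * x) / (1 + s * x) ^ N := by
    rw [e2]; field_simp
  have hbd : ∀ v, 0 < v → Mi (s * v) / (1 + s * v) ^ N ≤ 4 * C * M s * domF v := by
    intro v hv
    unfold domF
    by_cases h : s * v ≤ 1
    · have hm : s * v ∈ Ioc 0 1 := ⟨mul_pos hs0 hv, h⟩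
      rw [hMi, indicator_of_mem hm]
      have h1 := hpot s hs0 hs1 v hv h
      have h3 : (1 + v) ^ 2 / 4 ≤ (1 + s * v) ^ N := by
        have h4 : 1 + v / 2 ≤ (1 + s * v) ^ N := by
          have := one_add_mul_le_pow (a := s * v) (by nlinarith [hm.1]) N
          have e : (N:ℝ) * (s * v) = v := by rw [hsdef]; field_simp
          linarith
        obtain ⟨k, rfl | rfl⟩ := Nat.even_or_odd' N
        · have := one_add_mul_le_pow (a := s * v) (by nlinarith [hm.1]) k
          have e : (k:ℝ) * (s * v) = v / 2 := by
            rw [hsdef]; push_cast; have : (k:ℝ) ≠ 0 := by rintro h; simp [h] at hN0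
            field_simp
          rw [e] at this
          rw [pow_mul']
          have := pow_le_pow_left₀ (by positivity) this 2
          nlinarith
        · have h5 := one_add_mul_le_pow (a := s * v) (by nlinarith [hm.1]) k
          have h6 := one_add_mul_le_pow (a := s * v) (by nlinarith [hm.1]) (k+1)
          have e : (2 * (k:ℝ) + 1) * (s * v) = v := by
            rw [hsdef]; push_cast; have : 2 * (k:ℝ) + 1 ≠ 0 := by positivity
            field_simp
          have hk1 : (1:ℝ) ≤ k := by
            have : 1 ≤ k := by omega
            exact_mod_cast this
          have h7 := mul_le_mul h5 h6 (by positivity) (by positivity)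
          rw [← pow_add, show k + (k + 1) = 2 * k + 1 by ring] at h7
          refine le_trans ?_ h7
          push_cast
          have hx := hm.1
          set x := s * v
          rw [← e]
          nlinarith [mul_pos hx hx, mul_nonneg (mul_pos hx hx).le (sub_nonneg.2 hk1), mul_nonneg hx.le (sub_nonneg.2 hk1), mul_nonneg (mul_pos hx hx).le (mul_nonneg (sub_nonneg.2 hk1) (sub_nonneg.2 hk1))]
      have h2 : 0 < (1 + v) ^ 2 / 4 := by positivity
      calc M (s * v) / (1 + s * v) ^ N ≤ (C * (v ^ (1/2:ℝ) + v ^ (-(1/2):ℝ)) * M s) / ((1 + v) ^ 2 / 4) := by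
            gcongr
        _ = _ := by field_simp
    · rw [hMi, indicator_of_notMem (by simp only [mem_Ioc]; tauto)]
      simp only [zero_div]
      positivity
  have hnn : ∀ v, 0 < v → 0 ≤ Mi (s * v) / (1 + s * v) ^ N := fun v hv => by
    have := hMi0 (s * v); positivity
  have hint : IntegrableOn (fun v => Mi (s * v) / (1 + s * v) ^ N) (Ioi 0) := by
    refine (domF_integrable.const_mul (4 * C * M s)).mono' ?_ ?_
    · exact ((hMim.comp (measurable_const_mul s)).div (by fun_prop)).aestronglyMeasurable
    · filter_upwards [ae_restrict_mem measurableSet_Ioi] with v hv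
      rw [Real.norm_of_nonneg (hnn v hv)]
      exact hbd v hv
  rw [e1, e3]
  constructor
  · have h1 : ∫ v in Icc (1/2:ℝ) 1, M s / (3 * C * Real.exp 1) ≤ ∫ x in Icc (1/2:ℝ) 1, Mi (s * x) / (1 + s * x) ^ N := by
      refine setIntegral_mono_on (by simp) (hint.mono_set fun x hx => by
        have := hx.1; simp only [mem_Ioi]; linarith) measurableSet_Icc fun v hv => ?_
      have hv0 : 0 < v := by linarith [hv.1]
      have hm : s * v ∈ Ioc 0 1 := ⟨mul_pos hs0 hv0, by nlinarith [hv.2]⟩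
      rw [hMi, indicator_of_mem hm]
      have h2 := hpot (s * v) hm.1 hm.2 (1 / v) (by positivity) (by field_simp; exact hs1)
      rw [show s * v * (1 / v) = s by field_simp] at h2
      have h1v : 1 / v ≤ 2 := by rw [div_le_iff₀ hv0]; linarith [hv.1]
      have h1v' : 1 ≤ 1 / v := by rw [le_div_iff₀ hv0]; linarith [hv.2]
      have h3 : (1 / v) ^ (1/2:ℝ) ≤ 2 := 
        (Real.rpow_le_rpow_of_exponent_le h1v' (show (1/2:ℝ) ≤ 1 by norm_num)).trans (by simpa using h1v)
      have h4 : (1 / v) ^ (-(1/2):ℝ) ≤ 1 := Real.rpow_le_one_of_one_le_of_nonpos h1v' (by norm_num)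
      have hMsv := hp _ hm.1
      have h5 : M s ≤ 3 * C * M (s * v) := by
        refine h2.trans ?_
        rw [mul_comm 3 C]
        gcongr
        linarith
      have h6 : (1 + s * v) ^ N ≤ Real.exp 1 := by
        calc (1 + s * v) ^ N ≤ (Real.exp (s * v)) ^ N := by
              have := hm.1
              refine pow_le_pow_left₀ (by linarith) ?_ N
              linarith [Real.add_one_le_exp (s * v)]
          _ = Real.exp v := by
              rw [← Real.exp_nat_mul]; congr 1; rw [hsdef]; field_simp
          _ ≤ _ := Real.exp_le_exp.2 hv.2
      have h7 : 0 < (1 + s * v) ^ N := by have := hm.1; positivity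
      rw [div_le_div_iff₀ (by positivity) h7]
      calc M s * (1 + s * v) ^ N ≤ (3 * C * M (s * v)) * Real.exp 1 := by gcongr
        _ = _ := by ring
    have h2 : ∫ x in Icc (1/2:ℝ) 1, Mi (s * x) / (1 + s * x) ^ N ≤ ∫ x in Ioi 0, Mi (s * x) / (1 + s * x) ^ N := by
      refine setIntegral_mono_set hint ?_ ?_
      · filter_upwards [ae_restrict_mem measurableSet_Ioi] with v hv using hnn v hv
      · refine LE.le.eventuallyLE fun x hx => ?_
        have := hx.1; simp only [mem_Ioi]; linarith
    have h3 := h1.trans h2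
    rw [setIntegral_const] at h3
    simp only [Real.volume_real_Icc, smul_eq_mul] at h3
    rw [max_eq_left (by norm_num)] at h3
    have h4 := mul_le_mul_of_nonneg_left h3 hs0.le
    refine le_trans (le_of_eq ?_) h4
    rw [div_eq_mul_one_div (M s) (N:ℝ), ← hsdef]
    ring
  · have h1 : ∫ x in Ioi 0, Mi (s * x) / (1 + s * x) ^ N ≤ ∫ x in Ioi 0, 4 * C * M s * domF x :=
      setIntegral_mono_on hint (domF_integrable.const_mul _) measurableSet_Ioi fun v hv => hbd v hv
    rw [integral_const_mul] at h1
    have h4 := mul_le_mul_of_nonneg_left h1 hs0.le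
    refine h4.trans ?_
    rw [div_eq_mul_one_div (M s) (N:ℝ), ← hsdef]
    have : 0 < M s * s := by positivity
    change s * (4 * C * M s * I) ≤ _
    nlinarith

/-- finite measure with density `f` on `(0,1]`. -/
def muF (f : ℝ → ℝ) : Measure ℝ := (volume.restrict (Ioc 0 1)).withDensity (fun u => ENNReal.ofReal (f u))

/-- standard exponential measure -/
def expM : Measure ℝ := (volume.restrict (Ioi 0)).withDensity (fun u => ENNReal.ofReal (Real.exp (-u)))

lemma muF_finite (f : ℝ → ℝ) (hi : IntegrableOn f (Ioc 0 1)) : IsFiniteMeasure (muF f) :=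
  isFiniteMeasure_withDensity_ofReal hi.2

lemma int_exp (c : ℝ) (hc : 0 < c) : ∫ x in Ioi (0:ℝ), Real.exp (-(c * x)) = 1 / c := by
  have := integral_exp_neg_mul_rpow (p := 1) (b := c) one_pos hc
  simp at this
  rw [this]
  simp [Real.rpow_neg_one, one_add_one_eq_two, Real.Gamma_two]

lemma intble_exp (c : ℝ) (hc : 0 < c) : IntegrableOn (fun x : ℝ => Real.exp (-(c * x))) (Ioi 0) := by
  simpa [neg_mul] using exp_neg_integrableOn_Ioi 0 hc

lemma expM_finite : IsFiniteMeasure expM :=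
  isFiniteMeasure_withDensity_ofReal (by simpa using (intble_exp 1 one_pos).2)

lemma int_muF (f : ℝ → ℝ) (hm : AEMeasurable f (volume.restrict (Ioc 0 1))) (hp : ∀ u, 0 < u → 0 < f u)
    (φ : ℝ → ℝ) : ∫ u, φ u ∂(muF f) = ∫ u in Ioc 0 1, f u * φ u := by
  unfold muF
  rw [integral_withDensity_eq_integral_toReal_smul₀ hm.ennreal_ofReal (by simp)]
  refine setIntegral_congr_fun measurableSet_Ioc fun u hu => ?_
  simp [ENNReal.toReal_ofReal (hp u hu.1).le]

lemma int_expM (φ : ℝ → ℝ) : ∫ u, φ u ∂expM = ∫ u in Ioi 0, Real.exp (-u) * φ u := by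
  unfold expM
  rw [integral_withDensity_eq_integral_toReal_smul₀ (by fun_prop) (by simp)]
  refine setIntegral_congr_fun measurableSet_Ioi fun u hu => ?_
  simp [ENNReal.toReal_ofReal (Real.exp_pos _).le]

lemma ae_muF (f : ℝ → ℝ) : ∀ᵐ u ∂(muF f), 0 < u ∧ u ≤ 1 :=
  (withDensity_absolutelyContinuous _ _).ae_le (ae_restrict_mem measurableSet_Ioc)

lemma ae_expM : ∀ᵐ u ∂expM, 0 < u :=
  (withDensity_absolutelyContinuous _ _).ae_le (ae_restrict_mem measurableSet_Ioi)

/-- Levy measure -/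
def nuF (f : ℝ → ℝ) : Measure ℝ := ((muF f).prod expM).map (fun p => p.2 / p.1)

lemma ae_nuF (f : ℝ → ℝ) (hi : IntegrableOn f (Ioc 0 1)) : ∀ᵐ t ∂(nuF f), 0 < t := by
  have := muF_finite f hi
  have := expM_finite
  unfold nuF
  rw [ae_map_iff (by fun_prop) measurableSet_Ioi]
  have h1 : ∀ᵐ p ∂((muF f).prod expM), 0 < p.1 ∧ p.1 ≤ 1 := Measure.quasiMeasurePreserving_fst.ae (ae_muF f)
  have h2 : ∀ᵐ p ∂((muF f).prod expM), 0 < p.2 := Measure.quasiMeasurePreserving_snd.ae ae_expM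
  filter_upwards [h1, h2] with p h1 h2
  exact div_pos h2 h1.1

lemma nuF_finite (f : ℝ → ℝ) (hi : IntegrableOn f (Ioc 0 1)) : IsFiniteMeasure (nuF f) := by
  have := muF_finite f hi
  have := expM_finite
  unfold nuF
  infer_instance

lemma intble_nuF (f : ℝ → ℝ) (hi : IntegrableOn f (Ioc 0 1)) (φ : ℝ → ℝ) (hφ : Measurable φ) (B : ℝ)
    (hB : ∀ t, 0 < t → |φ t| ≤ B) : Integrable φ (nuF f) := by
  have := nuF_finite f hi
  refine Integrable.of_bound hφ.aestronglyMeasurable B ?_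
  filter_upwards [ae_nuF f hi] with t ht using hB t ht

lemma int_nuF (f : ℝ → ℝ) (hi : IntegrableOn f (Ioc 0 1)) (hp : ∀ u, 0 < u → 0 < f u)
    (φ : ℝ → ℝ) (hφ : Measurable φ) (B : ℝ)
    (hB : ∀ t, 0 < t → |φ t| ≤ B) :
    ∫ t, φ t ∂(nuF f) = ∫ u in Ioc 0 1, f u * ∫ x in Ioi 0, Real.exp (-x) * φ (x / u) := by
  have := muF_finite f hi
  have := expM_finite
  have h := intble_nuF f hi φ hφ B hB
  unfold nuF at *
  rw [integral_map (by fun_prop) hφ.aestronglyMeasurable]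
  rw [integrable_map_measure hφ.aestronglyMeasurable (by fun_prop)] at h
  have h' := integral_prod _ h
  simp only [Function.comp] at h'
  rw [h', int_muF f hi.aemeasurable hp]
  simp_rw [int_expM]

/-- the function `ψ`. -/
def psiF (f : ℝ → ℝ) (s : ℝ) : ℝ := ∫ u in Ioc 0 1, f u * (s / (s + u))

lemma psi_rep (f : ℝ → ℝ) (hi : IntegrableOn f (Ioc 0 1)) (hp : ∀ u, 0 < u → 0 < f u) :
    IsBernsteinRep (psiF f) 0 0 (nuF f) := by
  refine ⟨le_rfl, le_rfl, ?_, ?_, fun s hs => ?_⟩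
  · have := ae_nuF f hi
    rw [ae_iff] at this
    convert this using 2
    ext t; simp
  · refine intble_nuF f hi _ (by fun_prop) 1 fun t ht => ?_
    rw [abs_of_nonneg (by positivity), div_le_one (by positivity)]
    linarith
  · rw [int_nuF f hi hp _ (by fun_prop) 1 (fun t ht => by
      have h1 : Real.exp (-(s * t)) ≤ 1 := Real.exp_le_one_iff.2 (by nlinarith [mul_pos hs ht])
      have h2 := Real.exp_pos (-(s * t))
      rw [abs_le]; constructor <;> linarith)]
    simp only [zero_mul, zero_add, psiF]
    refine setIntegral_congr_fun measurableSet_Ioc fun u hu => ?_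
    have hu0 := hu.1
    beta_reduce
    congr 1
    have e : ∀ x : ℝ, Real.exp (-x) * (1 - Real.exp (-(s * (x / u)))) = 
        Real.exp (-(1 * x)) - Real.exp (-((1 + s / u) * x)) := by
      intro x
      rw [mul_sub, ← Real.exp_add]; ring_nf
    simp_rw [e]
    rw [integral_sub (intble_exp 1 one_pos) (intble_exp _ (by positivity)), int_exp _ one_pos,
      int_exp _ (by positivity)]
    field_simp
    ring

lemma cpsi_eq (f : ℝ → ℝ) (hi : IntegrableOn f (Ioc 0 1)) (hp : ∀ u, 0 < u → 0 < f u) (n : ℕ) (hn : 1 ≤ n) :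
    cPsi 0 (nuF f) n = ∫ u in Ioc 0 1, (u * f u) / (1 + u) ^ (n + 1) := by
  unfold cPsi
  rw [if_neg (by omega)]
  rw [int_nuF f hi hp _ (by fun_prop) (n.factorial) (fun t ht => by
    have h1 := Real.pow_div_factorial_le_exp t ht.le n
    rw [abs_of_nonneg (by positivity), Real.exp_neg, ← div_eq_mul_inv, div_le_iff₀ (by positivity)]
    rwa [div_le_iff₀ (by positivity), mul_comm] at h1)]
  simp only [ite_self, zero_add]
  rw [← integral_const_mul]
  refine setIntegral_congr_fun measurableSet_Ioc fun u hu => ?_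
  have hu0 := hu.1
  beta_reduce
  have e : ∀ x : ℝ, Real.exp (-x) * ((x / u) ^ n * Real.exp (-(x / u))) = 
      (1 / u ^ n) * (x ^ (((n : ℝ) + 1) - 1) * Real.exp (-((1 + 1 / u) * x))) := by
    intro x
    rw [add_sub_cancel_right, Real.rpow_natCast, div_pow, 
      show -((1 + 1 / u) * x) = -x + -(x / u) by ring, Real.exp_add]
    ring
  simp_rw [e]
  rw [integral_const_mul, Real.integral_rpow_mul_exp_neg_mul_Ioi (by positivity) (by positivity),
    Real.Gamma_nat_eq_factorial, show (n:ℝ) + 1 = ((n + 1 : ℕ) : ℝ) by push_cast; rfl, Real.rpow_natCast]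
  have : (n.factorial : ℝ) ≠ 0 := by positivity
  rw [show 1 / (1 + 1 / u) = u / (1 + u) by field_simp; ring, div_pow]
  field_simp
  ring

lemma psi_cbf (f : ℝ → ℝ) (hi : IntegrableOn f (Ioc 0 1)) (hp : ∀ u, 0 < u → 0 < f u) :
    IsCompleteBernstein (psiF f) := by
  have := muF_finite f hi
  set ν : Measure ℝ := (muF f).withDensity (fun u => ENNReal.ofReal (1 / u)) with hν
  have hint : ∀ φ : ℝ → ℝ, ∫ u, φ u ∂ν = ∫ u, φ u / u ∂(muF f) := by
    intro φ
    rw [hν, integral_withDensity_eq_integral_toReal_smul₀ (by fun_prop) (by simp)]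
    refine integral_congr_ae ?_
    filter_upwards [ae_muF f] with u hu
    have := hu.1
    rw [ENNReal.toReal_ofReal (by positivity), smul_eq_mul]
    ring
  refine ⟨fun t => ∫ u, (1 - Real.exp (-(t * u))) ∂ν, ⟨0, 0, ν, le_rfl, le_rfl, ?_, ?_, fun s hs => by simp⟩, ?_⟩
  · refine (withDensity_absolutelyContinuous _ _) ?_
    have := ae_muF f
    rw [ae_iff] at this
    refine measure_mono_null (fun t ht => ?_) this
    simp only [mem_Iic] at ht
    simp only [mem_ofPred_eq]
    intro h; linarith [h.1]
  · rw [hν, integrable_withDensity_iff_integrable_smul₀' (by fun_prop) (by simp)]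
    refine Integrable.of_bound (by fun_prop) 1 ?_
    filter_upwards [ae_muF f] with u hu
    have := hu.1
    rw [ENNReal.toReal_ofReal (by positivity), smul_eq_mul, Real.norm_of_nonneg (by positivity)]
    field_simp
    linarith
  · intro s hs
    have h1 : ∀ t, Real.exp (-(t * s)) * ∫ u, (1 - Real.exp (-(t * u))) ∂ν = 
        ∫ u, Real.exp (-(t * s)) * ((1 - Real.exp (-(t * u))) / u) ∂(muF f) := by
      intro t
      rw [hint, integral_const_mul]
    simp_rw [h1]
    rw [integral_integral_swap]
    · rw [psiF, int_muF f hi.aemeasurable hp, ← integral_const_mul]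
      refine setIntegral_congr_fun measurableSet_Ioc fun u hu => ?_
      have hu0 := hu.1
      beta_reduce
      have e : ∀ x : ℝ, Real.exp (-(x * s)) * ((1 - Real.exp (-(x * u))) / u) = 
          (Real.exp (-(s * x)) - Real.exp (-((s + u) * x))) * (1 / u) := by
        intro x
        rw [mul_div_assoc', mul_sub, ← Real.exp_add]; ring_nf
      simp_rw [e]
      rw [integral_mul_const, integral_sub (intble_exp _ hs) (intble_exp _ (by positivity)), int_exp _ hs,
        int_exp _ (by positivity)]
      field_simp
      ring
    · have hb : Integrable (fun p : ℝ × ℝ => (p.1 * Real.exp (-(s * p.1))) * 1) ((volume.restrict (Ioi 0)).prod (muF f)) := by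
        refine Integrable.mul_prod (f := fun t => t * Real.exp (-(s * t))) (g := fun _ => (1:ℝ)) ?_ (integrable_const _)
        have := integrableOn_rpow_mul_exp_neg_mul_rpow (p := 1) (s := 1) (b := s) (by norm_num) (by norm_num) hs
        simp only [Real.rpow_one, neg_mul] at this
        exact this
      refine hb.mono' (by apply Measurable.aestronglyMeasurable; fun_prop) ?_
      have h1 : ∀ᵐ p ∂((volume.restrict (Ioi 0)).prod (muF f)), (0:ℝ) < p.1 := 
        Measure.quasiMeasurePreserving_fst.ae (ae_restrict_mem measurableSet_Ioi)
      have h2 : ∀ᵐ p ∂((volume.restrict (Ioi (0:ℝ))).prod (muF f)), 0 < p.2 ∧ p.2 ≤ 1 := 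
        Measure.quasiMeasurePreserving_snd.ae (ae_muF f)
      filter_upwards [h1, h2] with p h1 h2
      have h3 : 0 ≤ 1 - Real.exp (-(p.1 * p.2)) := by
        have : Real.exp (-(p.1 * p.2)) ≤ 1 := Real.exp_le_one_iff.2 (by nlinarith [mul_pos h1 h2.1])
        linarith
      have h4 : 1 - Real.exp (-(p.1 * p.2)) ≤ p.1 * p.2 := by
        linarith [Real.add_one_le_exp (-(p.1 * p.2))]
      have h5 := h2.1
      simp only [Function.uncurry]
      rw [Real.norm_of_nonneg (by positivity), mul_one, mul_comm p.1 (Real.exp _), mul_comm s]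
      refine mul_le_mul_of_nonneg_left ?_ (Real.exp_pos _).le
      rwa [div_le_iff₀ h5]

lemma psi_deriv (f : ℝ → ℝ) (hi : IntegrableOn f (Ioc 0 1)) (s : ℝ) (hs : 0 < s) :
    HasDerivAt (psiF f) (∫ u in Ioc 0 1, (u * f u) / (s + u) ^ 2) s := by
  have hmeas : ∀ g : ℝ → ℝ, Measurable g → AEStronglyMeasurable (fun u => f u * g u) (volume.restrict (Ioc 0 1)) :=
    fun g hg => hi.aestronglyMeasurable.mul hg.aestronglyMeasurable
  have := hasDerivAt_integral_of_dominated_loc_of_deriv_le (μ := volume.restrict (Ioc (0:ℝ) 1))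
    (F := fun s u => f u * (s / (s + u))) (F' := fun s u => f u * (u / (s + u) ^ 2)) (x₀ := s)
    (s := Ioi (s / 2)) (bound := fun u => |f u| * (2 / s)) (Ioi_mem_nhds (by linarith)) ?_ ?_ ?_ ?_ ?_ ?_
  · refine this.2.congr_deriv ?_
    congr 1; ext u; ring
  · exact Eventually.of_forall fun x => hmeas _ (by fun_prop)
  · refine hi.abs.mono' (hmeas _ (by fun_prop)) ?_
    filter_upwards [ae_restrict_mem measurableSet_Ioc] with u hu
    have hu0 := hu.1
    rw [norm_mul, Real.norm_eq_abs, Real.norm_of_nonneg (by positivity)]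
    refine mul_le_of_le_one_right (abs_nonneg _) ?_
    rw [div_le_one (by positivity)]; linarith
  · exact hmeas _ (by fun_prop)
  · filter_upwards [ae_restrict_mem measurableSet_Ioc] with u hu x hx
    have hu0 := hu.1
    have hx : s / 2 < x := hx
    have hx0 : 0 < x := by linarith
    rw [norm_mul, Real.norm_eq_abs, Real.norm_of_nonneg (by positivity)]
    refine mul_le_mul_of_nonneg_left ?_ (abs_nonneg _)
    rw [div_le_div_iff₀ (by positivity) hs]
    nlinarith [mul_pos hx0 hu0]
  · exact hi.abs.mul_const _
  · filter_upwards [ae_restrict_mem measurableSet_Ioc] with u hu x hx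
    have hu0 := hu.1
    have hx : s / 2 < x := hx
    have hx0 : 0 < x := by linarith
    have h1 := ((hasDerivAt_id x).div ((hasDerivAt_id x).add_const u) (by simp; positivity)).const_mul (f u)
    refine HasDerivAt.congr_deriv (f := fun x => f u * (x / (x + u))) h1 ?_
    simp

lemma psi_zero (f : ℝ → ℝ) (hi : IntegrableOn f (Ioc 0 1)) :
    Tendsto (psiF f) (𝓝[>] 0) (𝓝 0) := by
  have : Tendsto (psiF f) (𝓝[>] 0) (𝓝 (∫ u in Ioc (0:ℝ) 1, (0:ℝ))) := by
    unfold psiF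
    apply tendsto_integral_filter_of_dominated_convergence (fun u => |f u|)
    · exact Eventually.of_forall fun x => hi.aestronglyMeasurable.mul (Measurable.aestronglyMeasurable (by fun_prop))
    · filter_upwards [self_mem_nhdsWithin] with s hs
      have hs : 0 < s := hs
      filter_upwards [ae_restrict_mem measurableSet_Ioc] with u hu
      have hu0 := hu.1
      rw [norm_mul, Real.norm_eq_abs, Real.norm_of_nonneg (by positivity)]
      refine mul_le_of_le_one_right (abs_nonneg _) ?_
      rw [div_le_one (by positivity)]; linarith
    · exact hi.abs
    · filter_upwards [ae_restrict_mem measurableSet_Ioc] with u hu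
      have hu0 := hu.1
      have : ContinuousAt (fun s => f u * (s / (s + u))) 0 := by
        have : (0:ℝ) + u ≠ 0 := by positivity
        exact continuousAt_const.mul (continuousAt_id.div (continuousAt_id.add continuousAt_const) this)
      have h := this.tendsto
      simp only [zero_div, mul_zero] at h
      exact h.mono_left nhdsWithin_le_nhds
  simpa using this

lemma seq_bounds (q : ℕ → ℝ) (hq : ∀ n, 0 < q n) (h : Tendsto q atTop (𝓝 1)) :
    ∃ m B : ℝ, 0 < m ∧ 0 < B ∧ ∀ n, m ≤ q n ∧ q n ≤ B := by
  obtain ⟨B, hB⟩ := h.bddAbove_range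
  obtain ⟨B', hB'⟩ := (h.inv₀ one_ne_zero).bddAbove_range
  have h1 : ∀ n, q n ≤ B := fun n => hB ⟨n, rfl⟩
  have h2 : ∀ n, (q n)⁻¹ ≤ B' := fun n => hB' ⟨n, rfl⟩
  have hB0 : 0 < B := (hq 0).trans_le (h1 0)
  have hB0' : 0 < B' := (inv_pos.2 (hq 0)).trans_le (h2 0)
  exact ⟨B'⁻¹, B, by positivity, hB0, fun n => ⟨inv_le_of_inv_le₀ (hq n) (h2 n), h1 n⟩⟩

/-- existence of a complete Bernstein function `ψ` with `ψ ∼ aψ₁`,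
`ψ′ ∼ aψ₁′` at `0⁺`, `ψ(1) = 1`, and `c(ψ,n) ≃ 1/((1+n)ℓ(1+n))`. -/
theorem statement17
    (l : ℝ → ℝ) (hlsv : SlowlyVarying l) (hlpos : ∀ x, 1 ≤ x → 0 < l x)
    (ψ₁ ψ₁d : ℝ → ℝ)
    (hψ₁deriv : ∀ s : ℝ, 0 < s → HasDerivAt ψ₁ (ψ₁d s) s)
    (hψ₁dcont : ContinuousOn ψ₁d (Set.Ioi 0))
    (hψ₁dpos : ∀ s : ℝ, 0 < s → 0 < ψ₁d s)
    (hψ₁pos : ∀ s : ℝ, 0 < s → 0 < ψ₁ s)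
    (hψ₁zero : Tendsto ψ₁ (nhdsWithin 0 (Set.Ioi 0)) (nhds 0))
    (hψ₁sv : SlowlyVarying (fun x => ψ₁ (1 / x)))
    (hψ₁dsv : SlowlyVarying (fun x => (1 / x) * ψ₁d (1 / x)))
    (hψ₁dasymp : Tendsto (fun s => ψ₁d s * (s * l (1 / s)))
      (nhdsWithin 0 (Set.Ioi 0)) (nhds 1)) :
    ∃ a : ℝ, 0 < a ∧ ∃ (ψ ψd : ℝ → ℝ) (b : ℝ) (ν : Measure ℝ),
      IsBernsteinRep ψ 0 b ν ∧ IsCompleteBernstein ψ ∧ ψ 1 = 1 ∧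
      Tendsto (fun s => ψ s / (a * ψ₁ s)) (nhdsWithin 0 (Set.Ioi 0)) (nhds 1) ∧
      (∀ s : ℝ, 0 < s → HasDerivAt ψ (ψd s) s) ∧
      Tendsto (fun s => ψd s / (a * ψ₁d s)) (nhdsWithin 0 (Set.Ioi 0)) (nhds 1) ∧
      ∃ c C : ℝ, 0 < c ∧ 0 < C ∧ ∀ n : ℕ, 1 ≤ n →
        c / ((1 + (n : ℝ)) * l (1 + (n : ℝ))) ≤ cPsi b ν n ∧
        cPsi b ν n ≤ C / ((1 + (n : ℝ)) * l (1 + (n : ℝ))) := by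
  have hi0 : IntegrableOn ψ₁d (Ioc 0 1) := by
    have hcont : ContinuousOn (Function.update ψ₁ 0 0) (Icc 0 1) := by
      intro x hx
      rcases hx.1.eq_or_lt with h | h
      · subst h
        refine ContinuousWithinAt.mono (t := Ici 0) ?_ (fun y hy => hy.1)
        rw [← Ioi_insert, continuousWithinAt_insert_self, continuousWithinAt_update_same]
        refine hψ₁zero.mono_left (nhdsWithin_mono _ ?_)
        exact fun y hy => hy.1
      · refine ContinuousAt.continuousWithinAt ?_
        rw [continuousAt_update_of_ne h.ne']
        exact (hψ₁deriv x h).continuousAt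
    refine intervalIntegral.integrableOn_deriv_of_nonneg hcont (fun x hx => ?_)
      (fun x hx => (hψ₁dpos x hx.1).le)
    refine (hψ₁deriv x hx.1).congr_of_eventuallyEq ?_
    filter_upwards [Ioi_mem_nhds hx.1] with y hy
    have hy : 0 < y := hy
    simp [Function.update_of_ne hy.ne']
  have hJ : 0 < psiF ψ₁d 1 := by
    unfold psiF
    have hint : IntegrableOn (fun u => ψ₁d u * (1 / (1 + u))) (Ioc 0 1) := by
      refine hi0.abs.mono' (hi0.aestronglyMeasurable.mul (Measurable.aestronglyMeasurable (by fun_prop))) ?_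
      filter_upwards [ae_restrict_mem measurableSet_Ioc] with u hu
      have hu0 := hu.1
      rw [norm_mul, Real.norm_eq_abs, Real.norm_of_nonneg (by positivity)]
      refine mul_le_of_le_one_right (abs_nonneg _) ?_
      rw [div_le_one (by positivity)]; linarith
    have hpos : ∀ u ∈ Ioc (0:ℝ) 1, 0 < ψ₁d u * (1 / (1 + u)) := fun u hu => by
      have := hu.1
      have := hψ₁dpos u hu.1
      positivity
    rw [setIntegral_pos_iff_support_of_nonneg_ae]
    · have : Ioc (0:ℝ) 1 ⊆ Function.support (fun u => ψ₁d u * (1 / (1 + u))) ∩ Ioc 0 1 :=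
        fun u hu => ⟨(hpos u hu).ne', hu⟩
      refine lt_of_lt_of_le ?_ (measure_mono this)
      simp
    · filter_upwards [ae_restrict_mem measurableSet_Ioc] with u hu using (hpos u hu).le
    · exact hint
  set a : ℝ := 1 / psiF ψ₁d 1 with ha
  have ha0 : 0 < a := by positivity
  set f : ℝ → ℝ := fun u => a * ψ₁d u with hf
  have hi : IntegrableOn f (Ioc 0 1) := hi0.const_mul a
  have hp : ∀ u, 0 < u → 0 < f u := fun u hu => mul_pos ha0 (hψ₁dpos u hu)
  set M : ℝ → ℝ := fun u => u * f u with hM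
  have hMc : ContinuousOn M (Ioi 0) := continuousOn_id.mul (continuousOn_const.mul hψ₁dcont)
  have hMp : ∀ u, 0 < u → 0 < M u := fun u hu => mul_pos hu (hp u hu)
  have hMs : ∀ v, 0 < v → Tendsto (fun s => M (s * v) / M s) (𝓝[>] 0) (𝓝 1) := by
    intro v hv
    refine ((hψ₁dsv (1 / v) (by positivity)).comp tendsto_inv_nhdsGT_zero).congr' ?_
    filter_upwards [self_mem_nhdsWithin] with s hs
    have hs : 0 < s := hs
    simp only [Function.comp, hM, hf]
    rw [show 1 / (1 / v * s⁻¹) = s * v by field_simp, show 1 / s⁻¹ = s by field_simp]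
    have := (hψ₁dpos s hs).ne'
    field_simp
  have hd : ∀ s : ℝ, 0 < s → HasDerivAt (psiF f) (∫ u in Ioc 0 1, M u / (s + u) ^ 2) s :=
    fun s hs => psi_deriv f hi s hs
  have hdlim : Tendsto (fun s => (∫ u in Ioc 0 1, M u / (s + u) ^ 2) / (a * ψ₁d s)) (𝓝[>] 0) (𝓝 1) := by
    refine (abel_lim M hMc hMp hMs).congr' ?_
    filter_upwards [self_mem_nhdsWithin] with s hs
    have hs : 0 < s := hs
    have := (hψ₁dpos s hs).ne'
    rw [div_eq_mul_inv _ (a * ψ₁d s)]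
    congr 1
    simp only [hM, hf]
    field_simp
  refine ⟨a, ha0, psiF f, fun s => ∫ u in Ioc 0 1, M u / (s + u) ^ 2, 0, nuF f, psi_rep f hi hp,
    psi_cbf f hi hp, ?_, ?_, hd, hdlim, ?_⟩
  · have : psiF f 1 = a * psiF ψ₁d 1 := by
      unfold psiF
      rw [← integral_const_mul]
      simp only [hf, mul_assoc]
    rw [this, ha]
    field_simp
  · refine HasDerivAt.lhopital_zero_nhdsGT (f' := fun s => ∫ u in Ioc 0 1, M u / (s + u) ^ 2)
      (g' := fun s => a * ψ₁d s) ?_ ?_ ?_ (psi_zero f hi) ?_ hdlim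
    · filter_upwards [self_mem_nhdsWithin] with s hs using hd s hs
    · filter_upwards [self_mem_nhdsWithin] with s hs using (hψ₁deriv s hs).const_mul a
    · filter_upwards [self_mem_nhdsWithin] with s hs using (hp s hs).ne'
    · simpa using hψ₁zero.const_mul a
  · obtain ⟨c, C, hc, hC, hb⟩ := coef_bounds M hMc hMp hMs
    obtain ⟨m, B, hm, hB, hq⟩ := seq_bounds
      (fun n : ℕ => ψ₁d (1 / ((n : ℝ) + 1)) * (1 / ((n : ℝ) + 1) * l (1 / (1 / ((n : ℝ) + 1))))) (by
        intro n
        have h1 : (0:ℝ) < 1 / ((n : ℝ) + 1) := by positivity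
        have h2 := hψ₁dpos _ h1
        have h3 := hlpos (1 / (1 / ((n : ℝ) + 1))) (by rw [one_div_one_div]; linarith [n.cast_nonneg (α := ℝ)])
        positivity) (by
        refine hψ₁dasymp.comp (tendsto_nhdsWithin_iff.2 ⟨tendsto_one_div_add_atTop_nhds_zero_nat, ?_⟩)
        exact Eventually.of_forall fun n => by simp only [mem_Ioi]; positivity)
    refine ⟨c * a * m, C * a * B, by positivity, by positivity, fun n hn => ?_⟩
    rw [cpsi_eq f hi hp n hn]
    obtain ⟨h1, h2⟩ := hb (n + 1) (by omega)
    obtain ⟨h3, h4⟩ := hq n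
    rw [one_div_one_div] at h3 h4
    have hl := hlpos (1 + (n:ℝ)) (by linarith [n.cast_nonneg (α := ℝ)])
    have e : M (1 / ((n + 1 : ℕ) : ℝ)) / ((n + 1 : ℕ) : ℝ) =
        a * (ψ₁d (1 / ((n : ℝ) + 1)) * (1 / ((n : ℝ) + 1) * l ((n : ℝ) + 1))) / ((1 + (n : ℝ)) * l (1 + (n : ℝ))) := by
      simp only [hM, hf]
      push_cast
      rw [add_comm (n:ℝ) 1]
      have h0 : (1 + (n:ℝ)) ≠ 0 := by positivity
      field_simp
    rw [e] at h1 h2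
    have hD : 0 < (1 + (n : ℝ)) * l (1 + (n : ℝ)) := by positivity
    generalize ψ₁d (1 / ((n : ℝ) + 1)) * (1 / ((n : ℝ) + 1) * l ((n : ℝ) + 1)) = q at h1 h2 h3 h4
    have hca : 0 < c * a := by positivity
    have hCa : 0 < C * a := by positivity
    constructor
    · refine le_trans ?_ h1
      rw [← mul_div_assoc c (a * q)]
      refine div_le_div_of_nonneg_right ?_ hD.le
      nlinarith
    · refine h2.trans ?_
      rw [← mul_div_assoc C (a * q)]
      refine div_le_div_of_nonneg_right ?_ hD.le
      nlinarith
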